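/- Let u be a classical solution with decay weight b of the Zakharov–Kuznetsov–Burgers problem on the strip S. Then for every t > 0: (d/dt)(e^{2bx}, u_x²)(t) + (2 + 6b)(e^{2bx}, u_{xx}²)(t) + 2b(e^{2bx}, u_{xy}²)(t) − (4b² + 8b³)(e^{2bx}, u_x²)(t) + (e^{2bx}, u_x³)(t) − 2b(e^{2bx}, u u_x²)(t) = 0. -/

import Mathlib

open MeasureTheory Real Set

/-- The mixed partial derivative `∂_x^i ∂_y^j ∂_t^k u` of a function
`u = u(x, y, t)`, evaluated at `(x, y, t)`. -/
noncomputable def pd (i j k : ℕ) (u : ℝ → ℝ → ℝ → ℝ) (x y t : ℝ) : ℝ :=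
  iteratedDeriv i (fun x' => iteratedDeriv j (fun y' => iteratedDeriv k (u x' y') t) y) x

/-- The strip `S = ℝ × (0, B)`. -/
def strip (B : ℝ) : Set (ℝ × ℝ) := Set.univ ×ˢ Set.Ioo 0 B

/-- A classical solution, with decay weight `b`, of the Zakharov–Kuznetsov–Burgers
initial-boundary value problem on the strip `S = ℝ × (0, B)`:
a smooth function `u(x, y, t)` satisfying the ZKB equation
`u_t - u_xx + u u_x + u_xxx + u_xyy = 0` in `ℝ × (0,B) × (0,∞)`, the Dirichlet
boundary conditions `u(x,0,t) = u(x,B,t) = 0`, and such that for every partial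
derivative `∂^α u` of order `|α| ≤ 5` in `x, y, t`, both `|∂^α u|²` and
`e^{2bx} |∂^α u|²` are integrable over `S` for each `t ≥ 0`, with integrals
bounded uniformly for `t` in compact subsets of `[0, ∞)`, and
`(1 + e^{2bx}) |∂^α u(x,y,t)|² → 0` as `|x| → ∞`, uniformly in `y` and locally
uniformly in `t`. -/
structure IsZKBSolution (B b : ℝ) (u : ℝ → ℝ → ℝ → ℝ) : Prop where
  smooth : ContDiff ℝ (⊤ : ℕ∞) (fun p : ℝ × ℝ × ℝ => u p.1 p.2.1 p.2.2)
  pde : ∀ x : ℝ, ∀ y ∈ Set.Ioo (0:ℝ) B, ∀ t : ℝ, 0 < t →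
    pd 0 0 1 u x y t - pd 2 0 0 u x y t + u x y t * pd 1 0 0 u x y t
      + pd 3 0 0 u x y t + pd 1 2 0 u x y t = 0
  bdry0 : ∀ x t : ℝ, 0 ≤ t → u x 0 t = 0
  bdryB : ∀ x t : ℝ, 0 ≤ t → u x B t = 0
  integ : ∀ i j k : ℕ, i + j + k ≤ 5 → ∀ t : ℝ, 0 ≤ t →
    IntegrableOn (fun p : ℝ × ℝ => (1 + Real.exp (2*b*p.1)) * (pd i j k u p.1 p.2 t)^2)
      (strip B) volume
  bdd : ∀ i j k : ℕ, i + j + k ≤ 5 → ∀ T : ℝ, ∃ M : ℝ, ∀ t ∈ Set.Icc (0:ℝ) T,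
    (∫ p in strip B, (1 + Real.exp (2*b*p.1)) * (pd i j k u p.1 p.2 t)^2) ≤ M
  decay : ∀ i j k : ℕ, i + j + k ≤ 5 → ∀ T : ℝ, ∀ ε : ℝ, 0 < ε → ∃ R : ℝ,
    ∀ x : ℝ, R ≤ |x| → ∀ y ∈ Set.Icc (0:ℝ) B, ∀ t ∈ Set.Icc (0:ℝ) T,
      (1 + Real.exp (2*b*x)) * (pd i j k u x y t)^2 ≤ ε

section DirectionalDerivative

variable {E : Type*} [NormedAddCommGroup E] [NormedSpace ℝ E]

/-- The derivative of `f` in the direction `v`. -/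
noncomputable def dirDeriv (v : E) (f : E → ℝ) (p : E) : ℝ := fderiv ℝ f p v

lemma contDiff_dirDeriv (v : E) {f : E → ℝ} (hf : ContDiff ℝ (⊤ : ℕ∞) f) :
    ContDiff ℝ (⊤ : ℕ∞) (dirDeriv v f) :=
  (hf.fderiv_right (m := (⊤ : ℕ∞)) (by simp)).clm_apply contDiff_const

lemma contDiff_iterate_dirDeriv (v : E) {f : E → ℝ} (hf : ContDiff ℝ (⊤ : ℕ∞) f) (n : ℕ) :
    ContDiff ℝ (⊤ : ℕ∞) ((dirDeriv v)^[n] f) := by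
  induction n with
  | zero => exact hf
  | succ n ih => rw [Function.iterate_succ_apply']; exact contDiff_dirDeriv v ih

lemma hasDerivAt_comp_dirDeriv {f : E → ℝ} (hf : ContDiff ℝ (⊤ : ℕ∞) f) {c : ℝ → E} {v : E} {s : ℝ}
    (hc : HasDerivAt c v s) : HasDerivAt (fun r => f (c r)) (dirDeriv v f (c s)) s :=
  ((hf.differentiable (by simp)) (c s)).hasFDerivAt.comp_hasDerivAt s hc

lemma iteratedDeriv_comp_eq_iterate_dirDeriv {f : E → ℝ} (hf : ContDiff ℝ (⊤ : ℕ∞) f) {c : ℝ → E}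
    {v : E} (hc : ∀ s, HasDerivAt c v s) (n : ℕ) (s : ℝ) :
    iteratedDeriv n (fun r => f (c r)) s = (dirDeriv v)^[n] f (c s) := by
  induction n generalizing s with
  | zero => simp
  | succ n ih =>
    rw [iteratedDeriv_succ, funext ih, Function.iterate_succ_apply']
    exact (hasDerivAt_comp_dirDeriv (contDiff_iterate_dirDeriv v hf n) (hc s)).deriv

lemma dirDeriv_comm (v w : E) {f : E → ℝ} (hf : ContDiff ℝ (⊤ : ℕ∞) f) :
    dirDeriv v (dirDeriv w f) = dirDeriv w (dirDeriv v f) := by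
  have key : ∀ a b : E, ∀ p, dirDeriv a (dirDeriv b f) p = fderiv ℝ (fderiv ℝ f) p a b := by
    intro a b p
    have hd : DifferentiableAt ℝ (fderiv ℝ f) p :=
      ((hf.fderiv_right (m := (⊤ : ℕ∞)) (by simp)).differentiable (by simp)) p
    change fderiv ℝ (fun q => fderiv ℝ f q b) p a = _
    rw [fderiv_clm_apply hd (differentiableAt_const b)]
    simp
  funext p
  rw [key, key]
  exact (hf.contDiffAt.isSymmSndFDerivAt (by
    rw [minSmoothness_of_isRCLikeNormedField]; exact WithTop.coe_le_coe.2 le_top)) v w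

lemma dirDeriv_iterate_comm (v w : E) {f : E → ℝ} (hf : ContDiff ℝ (⊤ : ℕ∞) f) (n : ℕ) :
    dirDeriv v ((dirDeriv w)^[n] f) = (dirDeriv w)^[n] (dirDeriv v f) := by
  induction n with
  | zero => rfl
  | succ n ih =>
    rw [Function.iterate_succ_apply', Function.iterate_succ_apply',
      dirDeriv_comm v w (contDiff_iterate_dirDeriv w hf n), ih]

end DirectionalDerivative

section MixedPartials

variable {u : ℝ → ℝ → ℝ → ℝ}

lemma pd_eq_iterate_dirDeriv (hu : ContDiff ℝ (⊤ : ℕ∞) (fun p : ℝ × ℝ × ℝ => u p.1 p.2.1 p.2.2))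
    (i j k : ℕ) (x y t : ℝ) :
    pd i j k u x y t = (dirDeriv (1, 0, 0))^[i] ((dirDeriv (0, 1, 0))^[j] ((dirDeriv (0, 0, 1))^[k]
      (fun p : ℝ × ℝ × ℝ => u p.1 p.2.1 p.2.2))) (x, y, t) := by
  have hct : ∀ x y s : ℝ, HasDerivAt (fun r : ℝ => (x, y, r)) ((0 : ℝ), (0 : ℝ), (1 : ℝ)) s :=
    fun x y s => (hasDerivAt_const s x).prodMk ((hasDerivAt_const s y).prodMk (hasDerivAt_id s))
  have hcy : ∀ x t s : ℝ, HasDerivAt (fun r : ℝ => (x, r, t)) ((0 : ℝ), (1 : ℝ), (0 : ℝ)) s :=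
    fun x t s => (hasDerivAt_const s x).prodMk ((hasDerivAt_id s).prodMk (hasDerivAt_const s t))
  have hcx : ∀ y t s : ℝ, HasDerivAt (fun r : ℝ => (r, y, t)) ((1 : ℝ), (0 : ℝ), (0 : ℝ)) s :=
    fun y t s => (hasDerivAt_id s).prodMk ((hasDerivAt_const s y).prodMk (hasDerivAt_const s t))
  have h1 : ∀ x y, iteratedDeriv k (u x y) t = _ := fun x y =>
    iteratedDeriv_comp_eq_iterate_dirDeriv hu (hct x y) k t
  have hk := contDiff_iterate_dirDeriv (0, 0, 1) hu k
  have h2 := fun x => iteratedDeriv_comp_eq_iterate_dirDeriv hk (hcy x t) j y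
  have h3 := iteratedDeriv_comp_eq_iterate_dirDeriv
    (contDiff_iterate_dirDeriv (0, 1, 0) hk j) (hcx y t) i x
  simp only [pd, h1, h2, h3]

lemma continuous_pd (hu : ContDiff ℝ (⊤ : ℕ∞) (fun p : ℝ × ℝ × ℝ => u p.1 p.2.1 p.2.2))
    (i j k : ℕ) : Continuous (fun p : ℝ × ℝ × ℝ => pd i j k u p.1 p.2.1 p.2.2) := by
  simp only [pd_eq_iterate_dirDeriv hu]
  exact (contDiff_iterate_dirDeriv _ (contDiff_iterate_dirDeriv _
    (contDiff_iterate_dirDeriv _ hu k) j) i).continuous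

lemma hasDerivAt_pd_x (hu : ContDiff ℝ (⊤ : ℕ∞) (fun p : ℝ × ℝ × ℝ => u p.1 p.2.1 p.2.2))
    (i j k : ℕ) (x y t : ℝ) :
    HasDerivAt (fun r => pd i j k u r y t) (pd (i + 1) j k u x y t) x := by
  simp only [pd_eq_iterate_dirDeriv hu, Function.iterate_succ_apply']
  exact hasDerivAt_comp_dirDeriv (contDiff_iterate_dirDeriv _ (contDiff_iterate_dirDeriv _
    (contDiff_iterate_dirDeriv _ hu k) j) i)
    ((hasDerivAt_id x).prodMk ((hasDerivAt_const x y).prodMk (hasDerivAt_const x t)))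

lemma hasDerivAt_pd_y (hu : ContDiff ℝ (⊤ : ℕ∞) (fun p : ℝ × ℝ × ℝ => u p.1 p.2.1 p.2.2))
    (i j k : ℕ) (x y t : ℝ) :
    HasDerivAt (fun r => pd i j k u x r t) (pd i (j + 1) k u x y t) y := by
  have hk := contDiff_iterate_dirDeriv (0, 0, 1) hu k
  have hj := contDiff_iterate_dirDeriv (0, 1, 0) hk j
  simp only [pd_eq_iterate_dirDeriv hu]
  rw [Function.iterate_succ_apply' _ j, ← dirDeriv_iterate_comm _ _ hj]
  exact hasDerivAt_comp_dirDeriv (contDiff_iterate_dirDeriv _ hj i)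
    ((hasDerivAt_const y x).prodMk ((hasDerivAt_id y).prodMk (hasDerivAt_const y t)))

lemma hasDerivAt_pd_t (hu : ContDiff ℝ (⊤ : ℕ∞) (fun p : ℝ × ℝ × ℝ => u p.1 p.2.1 p.2.2))
    (i j k : ℕ) (x y t : ℝ) :
    HasDerivAt (fun r => pd i j k u x y r) (pd i j (k + 1) u x y t) t := by
  have hk := contDiff_iterate_dirDeriv (0, 0, 1) hu k
  have hj := contDiff_iterate_dirDeriv (0, 1, 0) hk j
  simp only [pd_eq_iterate_dirDeriv hu]
  rw [Function.iterate_succ_apply' _ k, ← dirDeriv_iterate_comm _ _ hk,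
    ← dirDeriv_iterate_comm _ _ hj]
  exact hasDerivAt_comp_dirDeriv (contDiff_iterate_dirDeriv _ hj i)
    ((hasDerivAt_const t x).prodMk ((hasDerivAt_const t y).prodMk (hasDerivAt_id t)))

end MixedPartials

section Strip

variable {B : ℝ}

lemma measurableSet_strip : MeasurableSet (strip B) := MeasurableSet.univ.prod measurableSet_Ioo

lemma volume_restrict_strip :
    (volume : Measure (ℝ × ℝ)).restrict (strip B)
      = (volume : Measure ℝ).prod ((volume : Measure ℝ).restrict (Ioo 0 B)) := by
  have h := Measure.prod_restrict (μ := (volume : Measure ℝ)) (ν := (volume : Measure ℝ))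
    univ (Ioo 0 B)
  rw [Measure.restrict_univ] at h
  rw [h]
  rfl

lemma integral_strip_eq_zero_of_hasDerivAt_fst {F F' : ℝ × ℝ → ℝ}
    (hd : ∀ x y, HasDerivAt (fun r => F (r, y)) (F' (x, y)) x)
    (hF : IntegrableOn F (strip B)) (hF' : IntegrableOn F' (strip B)) :
    ∫ p in strip B, F' p = 0 := by
  rw [IntegrableOn, volume_restrict_strip] at hF hF'
  rw [volume_restrict_strip, integral_prod_symm _ hF']
  refine integral_eq_zero_of_ae ?_
  filter_upwards [hF.prod_left_ae, hF'.prod_left_ae] with y h h'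
  exact integral_eq_zero_of_hasDerivAt_of_integrable (fun x => hd x y) h' h

lemma integral_strip_eq_zero_of_hasDerivAt_snd (hB : 0 < B) {F F' : ℝ × ℝ → ℝ}
    (hd : ∀ x y, HasDerivAt (fun r => F (x, r)) (F' (x, y)) y)
    (h0 : ∀ x, F (x, 0) = 0) (h1 : ∀ x, F (x, B) = 0)
    (hF' : IntegrableOn F' (strip B)) :
    ∫ p in strip B, F' p = 0 := by
  rw [IntegrableOn, volume_restrict_strip] at hF'
  rw [volume_restrict_strip, integral_prod _ hF']
  refine integral_eq_zero_of_ae ?_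
  filter_upwards [hF'.prod_right_ae] with x h
  have hi : IntervalIntegrable (fun y => F' (x, y)) volume 0 B :=
    (intervalIntegrable_iff_integrableOn_Ioo_of_le hB.le).2 h
  have h2 := intervalIntegral.integral_eq_sub_of_hasDerivAt (fun y _ => hd x y) hi
  rw [intervalIntegral.integral_of_le hB.le, integral_Ioc_eq_integral_Ioo, h0, h1, sub_zero] at h2
  exact h2

/-- Differentiation under the integral sign when the second time derivative is only bounded in
`L¹` uniformly in time, rather than dominated pointwise. -/
lemma hasDerivAt_integral_of_integral_norm_le {α : Type*} [MeasurableSpace α] {μ : Measure α}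
    [SFinite μ] {F F' F'' : ℝ → α → ℝ} {t T M : ℝ} (ht : 0 < t) (htT : t < T)
    (hF : ∀ s, AEStronglyMeasurable (F s) μ)
    (hFt : Integrable (F t) μ) (hF'0 : Integrable (F' 0) μ)
    (hF' : AEStronglyMeasurable (F' t) μ)
    (hF'' : AEStronglyMeasurable (fun q : α × ℝ => F'' q.2 q.1)
      (μ.prod (volume.restrict (Ioc 0 T))))
    (hc : ∀ a, Continuous fun s => F'' s a)
    (hd : ∀ s a, HasDerivAt (fun r => F r a) (F' s a) s)
    (hd' : ∀ s a, HasDerivAt (fun r => F' r a) (F'' s a) s)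
    (hint : ∀ s ∈ Ioc 0 T, Integrable (F'' s) μ)
    (hM : ∀ s ∈ Ioc 0 T, ∫ a, ‖F'' s a‖ ∂μ ≤ M) :
    HasDerivAt (fun s => ∫ a, F s a ∂μ) (∫ a, F' t a ∂μ) t := by
  have hprod : Integrable (fun q : α × ℝ => F'' q.2 q.1) (μ.prod (volume.restrict (Ioc 0 T))) := by
    rw [integrable_prod_iff' hF'']
    refine ⟨(ae_restrict_mem measurableSet_Ioc).mono hint, ?_⟩
    refine Integrable.of_bound hF''.norm.prod_swap.integral_prod_right' M ?_
    filter_upwards [ae_restrict_mem measurableSet_Ioc] with s hs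
    rw [Real.norm_of_nonneg (integral_nonneg fun _ => norm_nonneg _)]
    exact hM s hs
  refine (hasDerivAt_integral_of_dominated_loc_of_deriv_le (Ioo_mem_nhds ht htT)
    (Filter.Eventually.of_forall hF) hFt hF' (Filter.Eventually.of_forall ?_)
    (hF'0.norm.add hprod.norm.integral_prod_left)
    (Filter.Eventually.of_forall fun a s _ => hd s a)).2
  intro a s hs
  have h1 := intervalIntegral.integral_eq_sub_of_hasDerivAt (fun r _ => hd' r a)
    ((hc a).intervalIntegrable 0 s)
  have h2 : F' s a = F' 0 a + ∫ r in (0 : ℝ)..s, F'' r a := by rw [h1]; ring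
  have h3 : ∫ r in (0 : ℝ)..s, ‖F'' r a‖ ≤ ∫ r in Ioc 0 T, ‖F'' r a‖ := by
    rw [intervalIntegral.integral_of_le hs.1.le]
    refine setIntegral_mono_set ?_ (Filter.Eventually.of_forall fun _ => norm_nonneg _)
      (Ioc_subset_Ioc_right hs.2.le).eventuallyLE
    exact (((hc a).norm.continuousOn).integrableOn_Icc).mono_set Ioc_subset_Icc_self
  rw [h2]
  exact (norm_add_le _ _).trans (add_le_add_right
    ((intervalIntegral.norm_integral_le_integral_norm hs.1.le).trans h3) _)

end Strip

namespace IsZKBSolution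

variable {B b : ℝ} {u : ℝ → ℝ → ℝ → ℝ}

lemma continuous_pd_slice (hu : IsZKBSolution B b u) (i j k : ℕ) (t : ℝ) :
    Continuous (fun p : ℝ × ℝ => pd i j k u p.1 p.2 t) :=
  (continuous_pd hu.smooth i j k).comp
    (continuous_fst.prodMk (continuous_snd.prodMk continuous_const))

lemma integrableOn_mul (hu : IsZKBSolution B b u) {t : ℝ} (ht : 0 ≤ t) (i j k i' j' k' : ℕ)
    (h : i + j + k ≤ 5) (h' : i' + j' + k' ≤ 5) :
    IntegrableOn (fun p : ℝ × ℝ =>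
      exp (2 * b * p.1) * (pd i j k u p.1 p.2 t * pd i' j' k' u p.1 p.2 t)) (strip B) := by
  refine Integrable.mono' ((hu.integ i j k h t ht).add (hu.integ i' j' k' h' t ht)) ?_
    (Filter.Eventually.of_forall fun p => ?_)
  · exact ((by fun_prop : Continuous fun p : ℝ × ℝ => exp (2 * b * p.1)).mul
      ((hu.continuous_pd_slice i j k t).mul
        (hu.continuous_pd_slice i' j' k' t))).aestronglyMeasurable
  · have he := exp_pos (2 * b * p.1)
    simp only [Pi.add_apply]
    generalize pd i j k u p.1 p.2 t = f
    generalize pd i' j' k' u p.1 p.2 t = g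
    rw [norm_mul, norm_of_nonneg he.le, norm_eq_abs, ← mul_add]
    refine mul_le_mul (by linarith) ?_ (abs_nonneg _) (by positivity)
    rw [abs_le]
    constructor <;> nlinarith [sq_nonneg (f + g), sq_nonneg (f - g), sq_nonneg f, sq_nonneg g]

lemma exists_abs_le (hu : IsZKBSolution B b u) {t : ℝ} (ht : 0 ≤ t) (i j k : ℕ)
    (h : i + j + k ≤ 5) : ∃ C, ∀ p ∈ strip B, |pd i j k u p.1 p.2 t| ≤ C := by
  obtain ⟨R, hR⟩ := hu.decay i j k h t 1 one_pos
  obtain ⟨C, hC⟩ := ((isCompact_Icc (a := -R) (b := R)).prod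
    (isCompact_Icc (a := (0 : ℝ)) (b := B))).exists_bound_of_continuousOn
    (hu.continuous_pd_slice i j k t).continuousOn
  refine ⟨max C 1, fun p hp => ?_⟩
  have hy : p.2 ∈ Icc 0 B := Ioo_subset_Icc_self hp.2
  rcases le_total R |p.1| with hx | hx
  · have h1 := hR p.1 hx p.2 hy t ⟨ht, le_rfl⟩
    refine le_max_of_le_right ?_
    rw [← sq_le_one_iff_abs_le_one]
    nlinarith [mul_nonneg (exp_pos (2 * b * p.1)).le (sq_nonneg (pd i j k u p.1 p.2 t))]
  · exact le_max_of_le_left (hC p ⟨abs_le.1 hx, hy⟩)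

lemma integrableOn_mul_mul (hu : IsZKBSolution B b u) {t : ℝ} (ht : 0 ≤ t)
    (i j k i' j' k' i'' j'' k'' : ℕ)
    (h : i + j + k ≤ 5) (h' : i' + j' + k' ≤ 5) (h'' : i'' + j'' + k'' ≤ 5) :
    IntegrableOn (fun p : ℝ × ℝ => exp (2 * b * p.1) *
      (pd i j k u p.1 p.2 t * pd i' j' k' u p.1 p.2 t) * pd i'' j'' k'' u p.1 p.2 t)
      (strip B) := by
  obtain ⟨C, hC⟩ := hu.exists_abs_le ht i'' j'' k'' h''
  refine Integrable.mul_bdd (c := C) (hu.integrableOn_mul ht i j k i' j' k' h h')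
    (hu.continuous_pd_slice i'' j'' k'' t).aestronglyMeasurable ?_
  filter_upwards [ae_restrict_mem measurableSet_strip] with p hp using hC p hp

/-- Integration by parts in `x` against the weight `e^{2bx}`. -/
lemma integral_by_parts_x (hu : IsZKBSolution B b u) {t : ℝ} (ht : 0 ≤ t)
    (i j k i' j' k' : ℕ) (h : i + j + k ≤ 4) (h' : i' + j' + k' ≤ 4) :
    2 * b * (∫ p in strip B,
        exp (2 * b * p.1) * (pd i j k u p.1 p.2 t * pd i' j' k' u p.1 p.2 t))
      + (∫ p in strip B,
        exp (2 * b * p.1) * (pd (i + 1) j k u p.1 p.2 t * pd i' j' k' u p.1 p.2 t))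
      + (∫ p in strip B,
        exp (2 * b * p.1) * (pd i j k u p.1 p.2 t * pd (i' + 1) j' k' u p.1 p.2 t)) = 0 := by
  have h1 := hu.integrableOn_mul ht i j k i' j' k' (by lia) (by lia)
  have h2 := hu.integrableOn_mul ht (i + 1) j k i' j' k' (by lia) (by lia)
  have h3 := hu.integrableOn_mul ht i j k (i' + 1) j' k' (by lia) (by lia)
  rw [← integral_const_mul, ← integral_add (h1.const_mul _) h2,
    ← integral_add ((h1.const_mul _).fun_add h2) h3]
  refine integral_strip_eq_zero_of_hasDerivAt_fst (fun x y => ?_) h1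
    (((h1.const_mul (2 * b)).fun_add h2).fun_add h3)
  have he : HasDerivAt (fun r => exp (2 * b * r)) (exp (2 * b * x) * (2 * b)) x := by
    simpa using ((hasDerivAt_id x).const_mul (2 * b)).exp
  refine HasDerivAt.congr_deriv (he.mul ((hasDerivAt_pd_x hu.smooth i j k x y t).mul
    (hasDerivAt_pd_x hu.smooth i' j' k' x y t))) ?_
  norm_num only
  ring

/-- Integration by parts in `x` of `e^{2bx} u u_x²`. -/
lemma integral_by_parts_x_cubic (hu : IsZKBSolution B b u) {t : ℝ} (ht : 0 ≤ t) :
    2 * b * (∫ p in strip B, exp (2 * b * p.1) *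
        (pd 1 0 0 u p.1 p.2 t * pd 1 0 0 u p.1 p.2 t) * pd 0 0 0 u p.1 p.2 t)
      + 2 * (∫ p in strip B, exp (2 * b * p.1) *
        (pd 1 0 0 u p.1 p.2 t * pd 2 0 0 u p.1 p.2 t) * pd 0 0 0 u p.1 p.2 t)
      + (∫ p in strip B, exp (2 * b * p.1) *
        (pd 1 0 0 u p.1 p.2 t * pd 1 0 0 u p.1 p.2 t) * pd 1 0 0 u p.1 p.2 t) = 0 := by
  have h1 := hu.integrableOn_mul_mul ht 1 0 0 1 0 0 0 0 0 (by lia) (by lia) (by lia)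
  have h2 := hu.integrableOn_mul_mul ht 1 0 0 2 0 0 0 0 0 (by lia) (by lia) (by lia)
  have h3 := hu.integrableOn_mul_mul ht 1 0 0 1 0 0 1 0 0 (by lia) (by lia) (by lia)
  rw [← integral_const_mul, ← integral_const_mul,
    ← integral_add (h1.const_mul _) (h2.const_mul _),
    ← integral_add ((h1.const_mul _).fun_add (h2.const_mul _)) h3]
  refine integral_strip_eq_zero_of_hasDerivAt_fst (fun x y => ?_) h1
    (((h1.const_mul (2 * b)).fun_add (h2.const_mul 2)).fun_add h3)
  have he : HasDerivAt (fun r => exp (2 * b * r)) (exp (2 * b * x) * (2 * b)) x := by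
    simpa using ((hasDerivAt_id x).const_mul (2 * b)).exp
  have hw := hasDerivAt_pd_x hu.smooth 1 0 0 x y t
  refine HasDerivAt.congr_deriv
    ((he.mul (hw.mul hw)).mul (hasDerivAt_pd_x hu.smooth 0 0 0 x y t)) ?_
  norm_num only [Pi.mul_apply]
  ring

/-- Integration by parts in `y` of `e^{2bx} u_x u_xxyy`. -/
lemma integral_by_parts_y (hu : IsZKBSolution B b u) (hB : 0 < B) {t : ℝ} (ht : 0 ≤ t) :
    (∫ p in strip B, exp (2 * b * p.1) * (pd 1 1 0 u p.1 p.2 t * pd 2 1 0 u p.1 p.2 t))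
      + (∫ p in strip B, exp (2 * b * p.1) * (pd 1 0 0 u p.1 p.2 t * pd 2 2 0 u p.1 p.2 t))
      = 0 := by
  have h2 := hu.integrableOn_mul ht 1 1 0 2 1 0 (by lia) (by lia)
  have h3 := hu.integrableOn_mul ht 1 0 0 2 2 0 (by lia) (by lia)
  rw [← integral_add h2 h3]
  refine integral_strip_eq_zero_of_hasDerivAt_snd (F := fun p =>
    exp (2 * b * p.1) * (pd 1 0 0 u p.1 p.2 t * pd 2 1 0 u p.1 p.2 t)) hB
    (fun x y => ?_) (fun x => ?_) (fun x => ?_) (h2.add h3)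
  · refine HasDerivAt.congr_deriv (((hasDerivAt_pd_y hu.smooth 1 0 0 x y t).mul
      (hasDerivAt_pd_y hu.smooth 2 1 0 x y t)).const_mul (exp (2 * b * x))) ?_
    norm_num only
    ring
  · simp [pd, hu.bdry0 _ t ht]
  · simp [pd, hu.bdryB _ t ht]

/-- The equation differentiated in `x`. -/
lemma pde_x (hu : IsZKBSolution B b u) (x : ℝ) {y : ℝ} (hy : y ∈ Ioo 0 B) {t : ℝ} (ht : 0 < t) :
    pd 1 0 1 u x y t - pd 3 0 0 u x y t
      + (pd 1 0 0 u x y t * pd 1 0 0 u x y t + pd 0 0 0 u x y t * pd 2 0 0 u x y t)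
      + pd 4 0 0 u x y t + pd 2 2 0 u x y t = 0 := by
  have hd := fun i j k => hasDerivAt_pd_x hu.smooth i j k x y t
  have h := ((((hd 0 0 1).sub (hd 2 0 0)).add ((hd 0 0 0).mul (hd 1 0 0))).add (hd 3 0 0)).add
    (hd 1 2 0)
  refine h.unique ((hasDerivAt_const x (0 : ℝ)).congr_of_eventuallyEq
    (Filter.Eventually.of_forall fun r => ?_))
  simpa [pd] using hu.pde r y hy t ht

lemma hasDerivAt_integral (hu : IsZKBSolution B b u) {t : ℝ} (ht : 0 < t) :
    HasDerivAt (fun τ => ∫ p in strip B, exp (2 * b * p.1) * (pd 1 0 0 u p.1 p.2 τ) ^ 2)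
      (∫ p in strip B,
        2 * (exp (2 * b * p.1) * (pd 1 0 0 u p.1 p.2 t * pd 1 0 1 u p.1 p.2 t))) t := by
  have he : Continuous fun p : ℝ × ℝ => exp (2 * b * p.1) := by fun_prop
  have hc := hu.continuous_pd_slice
  have hQ : ∀ s, 0 ≤ s → IntegrableOn (fun p : ℝ × ℝ =>
      2 * ((1 + exp (2 * b * p.1)) * (pd 1 0 1 u p.1 p.2 s) ^ 2)
        + (1 + exp (2 * b * p.1)) * (pd 1 0 0 u p.1 p.2 s) ^ 2
        + (1 + exp (2 * b * p.1)) * (pd 1 0 2 u p.1 p.2 s) ^ 2) (strip B) := fun s hs =>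
    (((hu.integ 1 0 1 (by lia) s hs).const_mul 2).add (hu.integ 1 0 0 (by lia) s hs)).add
      (hu.integ 1 0 2 (by lia) s hs)
  have hle : ∀ s (p : ℝ × ℝ), ‖2 * (exp (2 * b * p.1) * (pd 1 0 1 u p.1 p.2 s ^ 2
      + pd 1 0 0 u p.1 p.2 s * pd 1 0 2 u p.1 p.2 s))‖
      ≤ 2 * ((1 + exp (2 * b * p.1)) * (pd 1 0 1 u p.1 p.2 s) ^ 2)
        + (1 + exp (2 * b * p.1)) * (pd 1 0 0 u p.1 p.2 s) ^ 2
        + (1 + exp (2 * b * p.1)) * (pd 1 0 2 u p.1 p.2 s) ^ 2 := by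
    intro s p
    generalize pd 1 0 1 u p.1 p.2 s = f
    generalize pd 1 0 0 u p.1 p.2 s = g
    generalize pd 1 0 2 u p.1 p.2 s = h
    have hpos := exp_pos (2 * b * p.1)
    generalize exp (2 * b * p.1) = e at *
    rw [norm_eq_abs, abs_le]
    constructor <;>
      nlinarith [mul_nonneg hpos.le (sq_nonneg (g + h)), mul_nonneg hpos.le (sq_nonneg (g - h)),
        mul_nonneg hpos.le (sq_nonneg f), sq_nonneg f, sq_nonneg g, sq_nonneg h]
  have hint : ∀ s, 0 ≤ s → IntegrableOn (fun p : ℝ × ℝ => 2 * (exp (2 * b * p.1) *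
      (pd 1 0 1 u p.1 p.2 s ^ 2 + pd 1 0 0 u p.1 p.2 s * pd 1 0 2 u p.1 p.2 s))) (strip B) :=
    fun s hs => (hQ s hs).mono' (continuous_const.mul (he.mul (((hc 1 0 1 s).pow 2).add
      ((hc 1 0 0 s).mul (hc 1 0 2 s))))).aestronglyMeasurable
      (Filter.Eventually.of_forall (hle s))
  obtain ⟨M₁, hM₁⟩ := hu.bdd 1 0 1 (by lia) (t + 1)
  obtain ⟨M₀, hM₀⟩ := hu.bdd 1 0 0 (by lia) (t + 1)
  obtain ⟨M₂, hM₂⟩ := hu.bdd 1 0 2 (by lia) (t + 1)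
  refine hasDerivAt_integral_of_integral_norm_le (T := t + 1) (M := 2 * M₁ + M₀ + M₂)
    (F := fun s (p : ℝ × ℝ) => exp (2 * b * p.1) * (pd 1 0 0 u p.1 p.2 s) ^ 2)
    (F' := fun s p => 2 * (exp (2 * b * p.1) * (pd 1 0 0 u p.1 p.2 s * pd 1 0 1 u p.1 p.2 s)))
    (F'' := fun s p => 2 * (exp (2 * b * p.1) * (pd 1 0 1 u p.1 p.2 s ^ 2
      + pd 1 0 0 u p.1 p.2 s * pd 1 0 2 u p.1 p.2 s)))
    ht (by linarith) (fun s => (he.mul ((hc 1 0 0 s).pow 2)).aestronglyMeasurable) ?_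
    ((hu.integrableOn_mul le_rfl 1 0 0 1 0 1 (by lia) (by lia)).const_mul 2)
    (continuous_const.mul (he.mul ((hc 1 0 0 t).mul (hc 1 0 1 t)))).aestronglyMeasurable
    ?_ ?_ ?_ ?_ (fun s hs => hint s hs.1.le) ?_
  · simpa only [sq, IntegrableOn] using hu.integrableOn_mul ht.le 1 0 0 1 0 0 (by lia) (by lia)
  · have hj : ∀ i j k, Continuous fun q : (ℝ × ℝ) × ℝ => pd i j k u q.1.1 q.1.2 q.2 :=
      fun i j k => (continuous_pd hu.smooth i j k).comp
        (by fun_prop : Continuous fun q : (ℝ × ℝ) × ℝ => (q.1.1, q.1.2, q.2))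
    exact (continuous_const.mul ((he.comp continuous_fst).mul (((hj 1 0 1).pow 2).add
      ((hj 1 0 0).mul (hj 1 0 2))))).aestronglyMeasurable
  · intro p
    have hj : ∀ i j k, Continuous fun s => pd i j k u p.1 p.2 s :=
      fun i j k => (continuous_pd hu.smooth i j k).comp
        (by fun_prop : Continuous fun s : ℝ => (p.1, p.2, s))
    exact continuous_const.mul (continuous_const.mul (((hj 1 0 1).pow 2).add
      ((hj 1 0 0).mul (hj 1 0 2))))
  · intro s p
    refine HasDerivAt.congr_deriv (((hasDerivAt_pd_t hu.smooth 1 0 0 p.1 p.2 s).pow 2).const_mul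
      (exp (2 * b * p.1))) ?_
    norm_num only
    ring
  · intro s p
    refine HasDerivAt.congr_deriv ((((hasDerivAt_pd_t hu.smooth 1 0 0 p.1 p.2 s).mul
      (hasDerivAt_pd_t hu.smooth 1 0 1 p.1 p.2 s)).const_mul (exp (2 * b * p.1))).const_mul 2) ?_
    norm_num only
    ring
  · intro s hs
    have hs' : s ∈ Icc 0 (t + 1) := Ioc_subset_Icc_self hs
    refine (integral_mono (hint s hs'.1).norm (hQ s hs'.1) (hle s)).trans ?_
    rw [integral_add (((hu.integ 1 0 1 (by lia) s hs'.1).const_mul 2).fun_add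
      (hu.integ 1 0 0 (by lia) s hs'.1)) (hu.integ 1 0 2 (by lia) s hs'.1),
      integral_add ((hu.integ 1 0 1 (by lia) s hs'.1).const_mul 2)
      (hu.integ 1 0 0 (by lia) s hs'.1), integral_const_mul]
    linarith [hM₁ s hs', hM₀ s hs', hM₂ s hs']

/-- The differentiated equation tested against `e^{2bx} u_x`. -/
lemma integral_mul_pde_x (hu : IsZKBSolution B b u) {t : ℝ} (ht : 0 < t) :
    (∫ p in strip B, exp (2 * b * p.1) * (pd 1 0 0 u p.1 p.2 t * pd 1 0 1 u p.1 p.2 t))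
      = (∫ p in strip B, exp (2 * b * p.1) * (pd 1 0 0 u p.1 p.2 t * pd 3 0 0 u p.1 p.2 t))
      - (∫ p in strip B, exp (2 * b * p.1) *
          (pd 1 0 0 u p.1 p.2 t * pd 1 0 0 u p.1 p.2 t) * pd 1 0 0 u p.1 p.2 t)
      - (∫ p in strip B, exp (2 * b * p.1) *
          (pd 1 0 0 u p.1 p.2 t * pd 2 0 0 u p.1 p.2 t) * pd 0 0 0 u p.1 p.2 t)
      - (∫ p in strip B, exp (2 * b * p.1) * (pd 1 0 0 u p.1 p.2 t * pd 4 0 0 u p.1 p.2 t))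
      - (∫ p in strip B, exp (2 * b * p.1) * (pd 1 0 0 u p.1 p.2 t * pd 2 2 0 u p.1 p.2 t)) := by
  have h1 := hu.integrableOn_mul ht.le 1 0 0 3 0 0 (by lia) (by lia)
  have h2 := hu.integrableOn_mul_mul ht.le 1 0 0 1 0 0 1 0 0 (by lia) (by lia) (by lia)
  have h3 := hu.integrableOn_mul_mul ht.le 1 0 0 2 0 0 0 0 0 (by lia) (by lia) (by lia)
  have h4 := hu.integrableOn_mul ht.le 1 0 0 4 0 0 (by lia) (by lia)
  have h5 := hu.integrableOn_mul ht.le 1 0 0 2 2 0 (by lia) (by lia)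
  rw [← integral_sub h1 h2, ← integral_sub (h1.fun_sub h2) h3,
    ← integral_sub ((h1.fun_sub h2).fun_sub h3) h4,
    ← integral_sub (((h1.fun_sub h2).fun_sub h3).fun_sub h4) h5]
  refine setIntegral_congr_fun measurableSet_strip fun p hp => ?_
  linear_combination exp (2 * b * p.1) * pd 1 0 0 u p.1 p.2 t * hu.pde_x p.1 hp.2 ht

end IsZKBSolution

/-- **Weighted identity (3.16) of the paper (Estimate III)**: for a classical
solution `u` with decay weight `b` and every `t > 0`,
`(d/dt)(e^{2bx},u_x²)(t) + (2+6b)(e^{2bx},u_xx²)(t) + 2b(e^{2bx},u_xy²)(t)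
 − (4b²+8b³)(e^{2bx},u_x²)(t) + (e^{2bx},u_x³)(t) − 2b(e^{2bx},u u_x²)(t) = 0`. -/
theorem zkb_estimate_III_identity (B b : ℝ) (hB : 0 < B) (hb : 0 < b)
    (u : ℝ → ℝ → ℝ → ℝ) (hu : IsZKBSolution B b u) :
    ∀ t : ℝ, 0 < t →
      deriv (fun τ => ∫ p in strip B, Real.exp (2*b*p.1) * (pd 1 0 0 u p.1 p.2 τ)^2) t
        + (2 + 6*b) * (∫ p in strip B, Real.exp (2*b*p.1) * (pd 2 0 0 u p.1 p.2 t)^2)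
        + 2*b * (∫ p in strip B, Real.exp (2*b*p.1) * (pd 1 1 0 u p.1 p.2 t)^2)
        - (4*b^2 + 8*b^3) * (∫ p in strip B, Real.exp (2*b*p.1) * (pd 1 0 0 u p.1 p.2 t)^2)
        + (∫ p in strip B, Real.exp (2*b*p.1) * (pd 1 0 0 u p.1 p.2 t)^3)
        - 2*b * (∫ p in strip B,
            Real.exp (2*b*p.1) * u p.1 p.2 t * (pd 1 0 0 u p.1 p.2 t)^2)
      = 0 := by
  intro t ht
  rw [(hu.hasDerivAt_integral ht).deriv, integral_const_mul, hu.integral_mul_pde_x ht]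
  have hxx := hu.integral_by_parts_x ht.le 1 0 0 2 0 0 (by lia) (by lia)
  have hx := hu.integral_by_parts_x ht.le 1 0 0 1 0 0 (by lia) (by lia)
  have hxxx := hu.integral_by_parts_x ht.le 1 0 0 3 0 0 (by lia) (by lia)
  have hxx' := hu.integral_by_parts_x ht.le 2 0 0 2 0 0 (by lia) (by lia)
  have hy := hu.integral_by_parts_y hB ht.le
  have hxy := hu.integral_by_parts_x ht.le 1 1 0 1 1 0 (by lia) (by lia)
  have hcub := hu.integral_by_parts_x_cubic ht.le
  have hu0 : ∀ p : ℝ × ℝ, u p.1 p.2 t = pd 0 0 0 u p.1 p.2 t := fun p => by simp [pd]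
  have e1 : ∀ p : ℝ × ℝ, exp (2 * b * p.1) * u p.1 p.2 t * (pd 1 0 0 u p.1 p.2 t) ^ 2
      = exp (2 * b * p.1) * (pd 1 0 0 u p.1 p.2 t * pd 1 0 0 u p.1 p.2 t)
        * pd 0 0 0 u p.1 p.2 t := fun p => by rw [hu0]; ring
  have e2 : ∀ p : ℝ × ℝ, exp (2 * b * p.1) * (pd 1 0 0 u p.1 p.2 t) ^ 3
      = exp (2 * b * p.1) * (pd 1 0 0 u p.1 p.2 t * pd 1 0 0 u p.1 p.2 t)
        * pd 1 0 0 u p.1 p.2 t := fun p => by ring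
  have e3 : ∀ f g : ℝ × ℝ → ℝ, (∫ p in strip B, exp (2 * b * p.1) * (f p * g p))
      = ∫ p in strip B, exp (2 * b * p.1) * (g p * f p) := fun f g => by simp only [mul_comm (f _)]
  have c1 := e3 (fun p => pd 2 0 0 u p.1 p.2 t) (fun p => pd 1 0 0 u p.1 p.2 t)
  have c2 := e3 (fun p => pd 3 0 0 u p.1 p.2 t) (fun p => pd 2 0 0 u p.1 p.2 t)
  have c3 := e3 (fun p => pd 2 1 0 u p.1 p.2 t) (fun p => pd 1 1 0 u p.1 p.2 t)
  simp only [e1, e2]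
  simp only [sq (pd _ _ _ _ _ _ _)]
  norm_num only at hxx hx hxxx hxx' hy hxy hcub
  rw [c1] at hx
  rw [c2] at hxx'
  rw [c3] at hxy
  linear_combination 2 * hxx - 2 * b * hx - 2 * hxxx + hxx' + 4 * b * hxx - 4 * b ^ 2 * hx
    + hxy - hcub - 2 * hy
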